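/- For every positive integer m, the lattice ℤ⁴ has a geometrically similar sublattice of index m²: writing m = a² + b² + c² + d² with a, b, c, d ∈ ℤ, the ℤ-span of the rows of the matrix L_ξ = [[a, b, c, d], [−b, a, d, −c], [−c, −d, a, b], [−d, c, −b, a]] satisfies L_ξ·L_ξᵀ = m·I₄ and is a geometrically similar sublattice of ℤ⁴ of index m². Moreover, if m is odd this sublattice is clean. -/

import Mathlib

/-- The integer lattice `ℤ^L` inside `EuclideanSpace ℝ (Fin L)`. -/
noncomputable def Zlat (L : ℕ) : AddSubgroup (EuclideanSpace ℝ (Fin L)) :=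
  AddSubgroup.closure (Set.range fun i => EuclideanSpace.single i (1 : ℝ))

/-- `Λ'` is a geometrically similar sublattice of `Λ` of index `N`:
`Λ' = {c·O(v) : v ∈ Λ}` for some `c > 0` and orthogonal matrix `O`, with
`[Λ : Λ'] = N`. -/
noncomputable def IsSimilarSublattice {L : ℕ}
    (Λ Λ' : AddSubgroup (EuclideanSpace ℝ (Fin L))) (N : ℕ) : Prop :=
  Λ' ≤ Λ ∧ (Λ'.addSubgroupOf Λ).index = N ∧
    ∃ (c : ℝ) (O : Matrix (Fin L) (Fin L) ℝ), 0 < c ∧ O * O.transpose = 1 ∧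
      Λ' = AddSubgroup.map (c • Matrix.toEuclideanLin O).toAddMonoidHom Λ

/-- The `ℤ`-span of the rows of an integer matrix `K`, as a sublattice of `ℝ^L`. -/
noncomputable def rowLattice {L : ℕ} (K : Matrix (Fin L) (Fin L) ℤ) :
    AddSubgroup (EuclideanSpace ℝ (Fin L)) :=
  AddSubgroup.closure
    (Set.range fun i => (WithLp.equiv 2 (Fin L → ℝ)).symm fun j => (K i j : ℝ))

/-- `Λ'` is clean in `Λ`: every point of `Λ` has a unique nearest point of `Λ'`
in the Euclidean norm. -/
def IsClean {L : ℕ} (Λ Λ' : AddSubgroup (EuclideanSpace ℝ (Fin L))) : Prop :=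
  ∀ x ∈ Λ, ∃! p, p ∈ Λ' ∧ ∀ q ∈ Λ', ‖x - p‖ ≤ ‖x - q‖

/-- The matrix `L_ξ` of left multiplication by the quaternion `ξ = a + bi + cj + dk`. -/
def Lxi (a b c d : ℤ) : Matrix (Fin 4) (Fin 4) ℤ :=
  !![a, b, c, d;
     -b, a, d, -c;
     -c, -d, a, b;
     -d, c, -b, a]

/-- The inclusion of integer vectors into Euclidean space. -/
noncomputable def intVec (L : ℕ) : (Fin L → ℤ) →+ EuclideanSpace ℝ (Fin L) where
  toFun v := WithLp.toLp 2 fun j => (v j : ℝ)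
  map_zero' := by ext; simp
  map_add' v w := by ext; simp

theorem intVec_injective (L : ℕ) : Function.Injective (intVec L) := by
  intro v w hvw
  funext i
  have := congrArg (fun x : EuclideanSpace ℝ (Fin L) => x i) hvw
  simpa [intVec] using this

theorem norm_intVec_sq {L : ℕ} (v : Fin L → ℤ) :
    ‖intVec L v‖ ^ 2 = ((v ⬝ᵥ v : ℤ) : ℝ) := by
  rw [EuclideanSpace.real_norm_sq_eq]
  simp [intVec, dotProduct, pow_two]

theorem rowLattice_eq_map {L : ℕ} (K : Matrix (Fin L) (Fin L) ℤ) :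
    rowLattice K = (LinearMap.range K.vecMulLinear).toAddSubgroup.map (intVec L) := by
  have hspan : (LinearMap.range K.vecMulLinear).toAddSubgroup
      = AddSubgroup.closure (Set.range K.row) := by
    rw [range_vecMulLinear]
    exact Submodule.span_int_eq_addSubgroupClosure _
  rw [hspan, AddMonoidHom.map_closure, ← Set.range_comp]
  rfl

theorem mem_rowLattice_iff {L : ℕ} (K : Matrix (Fin L) (Fin L) ℤ)
    (x : EuclideanSpace ℝ (Fin L)) :
    x ∈ rowLattice K ↔ ∃ z : Fin L → ℤ, intVec L (Matrix.vecMul z K) = x := by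
  rw [rowLattice_eq_map]
  simp

theorem Zlat_eq_rowLattice_one (L : ℕ) : Zlat L = rowLattice (1 : Matrix (Fin L) (Fin L) ℤ) := by
  unfold Zlat rowLattice
  congr 2
  funext i
  ext j
  simp [Matrix.one_apply, eq_comm]

theorem Zlat_eq_map (L : ℕ) : Zlat L = (⊤ : AddSubgroup (Fin L → ℤ)).map (intVec L) := by
  rw [Zlat_eq_rowLattice_one]
  ext x
  simp [mem_rowLattice_iff]

theorem mem_Zlat_iff {L : ℕ} (x : EuclideanSpace ℝ (Fin L)) :
    x ∈ Zlat L ↔ ∃ v : Fin L → ℤ, intVec L v = x := by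
  simp [Zlat_eq_map]

theorem index_range_vecMulLinear {L : ℕ} (K : Matrix (Fin L) (Fin L) ℤ) (hK : K.det ≠ 0) :
    (LinearMap.range K.vecMulLinear).toAddSubgroup.index = K.det.natAbs := by
  have hinj : Function.Injective K.vecMulLinear :=
    (injective_iff_map_eq_zero _).mpr fun _ hv => Matrix.eq_zero_of_vecMul_eq_zero hK hv
  let e := (LinearEquiv.ofInjective K.vecMulLinear hinj).toAddEquiv
  have hcomp : (LinearMap.range K.vecMulLinear).subtype ∘ₗ
      AddMonoidHom.toIntLinearMap (e : _ →+ LinearMap.range K.vecMulLinear) =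
      Matrix.toLin' K.transpose := by
    ext v
    simp [e]
  have hdet := Submodule.natAbs_det_equiv (LinearMap.range K.vecMulLinear) e
  rw [hcomp, LinearMap.det_toLin', Matrix.det_transpose] at hdet
  exact hdet.symm

theorem rowLattice_le_Zlat {L : ℕ} (K : Matrix (Fin L) (Fin L) ℤ) : rowLattice K ≤ Zlat L := by
  rw [rowLattice_eq_map, Zlat_eq_map]
  exact AddSubgroup.map_mono le_top

theorem index_rowLattice {L : ℕ} (K : Matrix (Fin L) (Fin L) ℤ) (hK : K.det ≠ 0) :
    ((rowLattice K).addSubgroupOf (Zlat L)).index = K.det.natAbs := by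
  rw [← index_range_vecMulLinear K hK, ← AddSubgroup.relIndex_top_right (H := (LinearMap.range K.vecMulLinear).toAddSubgroup),
    ← AddSubgroup.relIndex_map_map_of_injective _ _ (intVec_injective L),
    ← rowLattice_eq_map, ← Zlat_eq_map]
  rfl

theorem transpose_mul_self_of_mul_transpose {R : Type*} [Field R] {L : ℕ}
    {K : Matrix (Fin L) (Fin L) R} {m : R} (hm : m ≠ 0) (hK : K * K.transpose = m • 1) :
    K.transpose * K = m • 1 := by
  have h1 : K * (m⁻¹ • K.transpose) = 1 := by
    rw [Matrix.mul_smul, hK, smul_smul, inv_mul_cancel₀ hm, one_smul]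
  have h2 := mul_eq_one_comm.mp h1
  rw [← h2, Matrix.smul_mul, smul_smul, mul_inv_cancel₀ hm, one_smul]

theorem map_cast_smul_one {L : ℕ} (m : ℕ) :
    ((m : ℤ) • (1 : Matrix (Fin L) (Fin L) ℤ)).map (Int.castRingHom ℝ) = (m : ℝ) • 1 := by
  ext i j
  by_cases hij : i = j <;>
    simp only [Matrix.map_apply, Matrix.smul_apply, Matrix.one_apply, hij] <;> simp

section ScaledOrthogonal

variable {L m : ℕ} {K : Matrix (Fin L) (Fin L) ℤ}

theorem transpose_mul_self_cast (hm : 0 < m) (hK : K * K.transpose = (m : ℤ) • 1) :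
    (K.map (Int.cast : ℤ → ℝ)).transpose * K.map (Int.cast : ℤ → ℝ) = (m : ℝ) • 1 := by
  refine transpose_mul_self_of_mul_transpose (by positivity) ?_
  have := congrArg (fun M : Matrix (Fin L) (Fin L) ℤ => M.map (Int.castRingHom ℝ)) hK
  simp only [Matrix.map_mul] at this
  rw [← Matrix.transpose_map]
  exact this.trans (map_cast_smul_one m)

theorem transpose_mul_self_int (hm : 0 < m) (hK : K * K.transpose = (m : ℤ) • 1) :
    K.transpose * K = (m : ℤ) • 1 := by
  apply Matrix.map_injective (Int.castRingHom ℝ).injective_int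
  have := transpose_mul_self_cast hm hK
  exact Matrix.map_mul.trans (this.trans (map_cast_smul_one m).symm)

theorem rowLattice_similar (hm : 0 < m) (hK : K * K.transpose = (m : ℤ) • 1) :
    ∃ (c : ℝ) (O : Matrix (Fin L) (Fin L) ℝ), 0 < c ∧ O * O.transpose = 1 ∧
      rowLattice K = AddSubgroup.map (c • Matrix.toEuclideanLin O).toAddMonoidHom (Zlat L) := by
  have hm' : (0 : ℝ) < m := by exact_mod_cast hm
  have hs : 0 < √(m : ℝ) := Real.sqrt_pos.mpr hm'
  refine ⟨√m, (√(m : ℝ))⁻¹ • (K.map (Int.cast : ℤ → ℝ)).transpose, hs, ?_, ?_⟩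
  · rw [Matrix.transpose_smul, Matrix.transpose_transpose, Matrix.smul_mul, Matrix.mul_smul,
      transpose_mul_self_cast hm hK, smul_smul, smul_smul, ← mul_inv, Real.mul_self_sqrt hm'.le,
      inv_mul_cancel₀ hm'.ne', one_smul]
  · rw [← map_smul, smul_smul, mul_inv_cancel₀ hs.ne', one_smul]
    have key (v : Fin L → ℤ) :
        Matrix.toEuclideanLin (K.map (Int.cast : ℤ → ℝ)).transpose (intVec L v) =
          intVec L (Matrix.vecMul v K) := by
      ext j
      simp [intVec, Matrix.vecMul, Matrix.mulVec, dotProduct, mul_comm]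
    ext x
    simp only [mem_rowLattice_iff, AddSubgroup.mem_map, mem_Zlat_iff]
    constructor
    · rintro ⟨z, rfl⟩
      exact ⟨_, ⟨z, rfl⟩, key z⟩
    · rintro ⟨_, ⟨z, rfl⟩, rfl⟩
      exact ⟨z, (key z).symm⟩

theorem mul_norm_sub_sq (hm : 0 < m) (hK : K * K.transpose = (m : ℤ) • 1) (v z : Fin L → ℤ) :
    m * ‖intVec L v - intVec L (Matrix.vecMul z K)‖ ^ 2 =
      ((∑ i, (K.mulVec v i - m * z i) ^ 2 : ℤ) : ℝ) := by
  have hu : K.mulVec (v - Matrix.vecMul z K) = fun i => K.mulVec v i - m * z i := by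
    rw [Matrix.mulVec_sub, ← Matrix.mulVec_transpose, Matrix.mulVec_mulVec, hK,
      Matrix.smul_mulVec, Matrix.one_mulVec]
    ext i
    simp
  have hn (u : Fin L → ℤ) : (m : ℤ) * (u ⬝ᵥ u) = K.mulVec u ⬝ᵥ K.mulVec u := by
    rw [Matrix.dotProduct_mulVec, ← Matrix.mulVec_transpose, Matrix.mulVec_mulVec,
      transpose_mul_self_int hm hK, Matrix.smul_mulVec, Matrix.one_mulVec, smul_dotProduct,
      smul_eq_mul]
  rw [← map_sub, norm_intVec_sq]
  have := hn (v - Matrix.vecMul z K)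
  rw [hu] at this
  simp only [pow_two]
  exact_mod_cast this

theorem sq_lt_sq_of_ne_of_two_mul_abs_lt {w m y z : ℤ} (h : 2 * |w - m * z| < m) (hne : y ≠ z) :
    (w - m * z) ^ 2 < (w - m * y) ^ 2 := by
  rw [sq_lt_sq]
  have hm : 0 < m := lt_of_le_of_lt (by positivity) h
  have h1 : m * 1 ≤ m * |z - y| :=
    mul_le_mul_of_nonneg_left (Int.one_le_abs (sub_ne_zero.mpr hne.symm)) hm.le
  have h2 : m * |z - y| = |(w - m * y) - (w - m * z)| := by
    rw [← abs_of_pos hm, ← abs_mul, abs_of_pos hm]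
    congr 1
    ring
  have h3 := abs_sub (w - m * y) (w - m * z)
  linarith

theorem exists_two_mul_abs_sub_lt (hodd : Odd m) (w : ℤ) : ∃ z : ℤ, 2 * |w - m * z| < m := by
  have hm := hodd.pos
  refine ⟨w.bdiv m, ?_⟩
  have h0 := Int.bmod_add_bdiv w m
  have h1 := Int.le_bmod (x := w) hm
  have h2 := Int.bmod_lt (x := w) hm
  obtain ⟨k, rfl⟩ := hodd
  have h3 : w - ((2 * k + 1 : ℕ) : ℤ) * w.bdiv (2 * k + 1) = w.bmod (2 * k + 1) := by linarith
  rw [h3]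
  rcases abs_cases (w.bmod (2 * k + 1)) with h | h <;> omega

theorem rowLattice_isClean (hodd : Odd m) (hK : K * K.transpose = (m : ℤ) • 1) :
    IsClean (Zlat L) (rowLattice K) := by
  have hm := hodd.pos
  have hm' : (0 : ℝ) < m := by exact_mod_cast hm
  intro x hx
  obtain ⟨v, rfl⟩ := (mem_Zlat_iff x).mp hx
  choose z hz using fun i => exists_two_mul_abs_sub_lt hodd (K.mulVec v i)
  have hle_iff (y y' : Fin L → ℤ) :
      ‖intVec L v - intVec L (Matrix.vecMul y K)‖ ≤ ‖intVec L v - intVec L (Matrix.vecMul y' K)‖ ↔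
        ∑ i, (K.mulVec v i - m * y i) ^ 2 ≤ ∑ i, (K.mulVec v i - m * y' i) ^ 2 := by
    rw [← sq_le_sq₀ (norm_nonneg _) (norm_nonneg _), ← mul_le_mul_iff_right₀ hm',
      mul_norm_sub_sq hm hK, mul_norm_sub_sq hm hK, Int.cast_le]
  have hcoord (y : Fin L → ℤ) (i : Fin L) :
      (K.mulVec v i - m * z i) ^ 2 ≤ (K.mulVec v i - m * y i) ^ 2 := by
    by_cases hy : y i = z i
    · rw [hy]
    · exact (sq_lt_sq_of_ne_of_two_mul_abs_lt (hz i) hy).le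
  refine ⟨intVec L (Matrix.vecMul z K), ⟨(mem_rowLattice_iff _ _).mpr ⟨z, rfl⟩, ?_⟩, ?_⟩
  · intro q hq
    obtain ⟨y, rfl⟩ := (mem_rowLattice_iff _ _).mp hq
    exact (hle_iff _ _).mpr (Finset.sum_le_sum fun i _ => hcoord y i)
  · rintro p ⟨hp, hmin⟩
    obtain ⟨y, rfl⟩ := (mem_rowLattice_iff _ _).mp hp
    have hyz : y = z := by
      by_contra hne
      obtain ⟨i, hi⟩ := Function.ne_iff.mp hne
      refine ((hle_iff _ _).mp (hmin _ ((mem_rowLattice_iff _ _).mpr ⟨z, rfl⟩))).not_gt ?_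
      exact Finset.sum_lt_sum (fun j _ => hcoord y j)
        ⟨i, Finset.mem_univ i, sq_lt_sq_of_ne_of_two_mul_abs_lt (hz i) hi⟩
    rw [hyz]

end ScaledOrthogonal

theorem Lxi_mul_transpose (a b c d : ℤ) :
    Lxi a b c d * (Lxi a b c d).transpose = (a ^ 2 + b ^ 2 + c ^ 2 + d ^ 2) • 1 := by
  ext i j
  fin_cases i <;> fin_cases j <;> simp [Lxi, Matrix.mul_apply, Fin.sum_univ_four] <;> ring

theorem natAbs_det_of_mul_transpose {K : Matrix (Fin 4) (Fin 4) ℤ} {m : ℕ}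
    (hK : K * K.transpose = (m : ℤ) • 1) : K.det.natAbs = m ^ 2 := by
  have hdet := congrArg Matrix.det hK
  rw [Matrix.det_mul, Matrix.det_transpose, Matrix.det_smul, Matrix.det_one, Fintype.card_fin,
    mul_one] at hdet
  have hsq : K.det ^ 2 = ((m : ℤ) ^ 2) ^ 2 := by rw [pow_two, hdet]; ring
  have := Int.natAbs_eq_iff_sq_eq.mpr hsq
  simpa [Int.natAbs_pow] using this

theorem stmt10 (m : ℕ) (hm : 0 < m) (a b c d : ℤ)
    (h : (m : ℤ) = a ^ 2 + b ^ 2 + c ^ 2 + d ^ 2) :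
    Lxi a b c d * (Lxi a b c d).transpose = (m : ℤ) • (1 : Matrix (Fin 4) (Fin 4) ℤ) ∧
      IsSimilarSublattice (Zlat 4) (rowLattice (Lxi a b c d)) (m ^ 2) ∧
      (Odd m → IsClean (Zlat 4) (rowLattice (Lxi a b c d))) := by
  have hK : Lxi a b c d * (Lxi a b c d).transpose = (m : ℤ) • 1 := by
    rw [h, Lxi_mul_transpose]
  have hdet := natAbs_det_of_mul_transpose hK
  have hdet0 : (Lxi a b c d).det ≠ 0 := by
    rw [← Int.natAbs_ne_zero, hdet]
    positivity
  exact ⟨hK, ⟨rowLattice_le_Zlat _, (index_rowLattice _ hdet0).trans hdet,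
    rowLattice_similar hm hK⟩, fun hodd => rowLattice_isClean hodd hK⟩
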